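/- Fix z ∈ V. As |s_0| → −∞, for every i ∈ V, every ρ ∈ Rec(z) and every m ∈ ℕ, the probability P_{s_0}{(i_τ, ρ_τ, m_τ) = (i, ρ, m)} converges to (α_i/κ)·1{0 ≤ m ≤ |â_i⁻¹ρ| − |ρ|}. -/

import Mathlib

open scoped BigOperators
open Classical Filter

noncomputable section

namespace ThresholdState

variable {V : Type*} [Fintype V] [DecidableEq V]

/-- `A i j` is the number of directed edges from `i` to `j`. -/
def outdeg (A : V → V → ℕ) (i : V) : ℕ := ∑ j, A i j

def indeg (A : V → V → ℕ) (i : V) : ℕ := ∑ j, A j i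

/-- Eulerian: out-degree equals in-degree at every vertex. -/
def Eulerian (A : V → V → ℕ) : Prop := ∀ i, outdeg A i = indeg A i

/-- (Strongly) connected multigraph. -/
def Connected (A : V → V → ℕ) : Prop :=
  ∀ i j : V, Relation.ReflTransGen (fun a b => 0 < A a b) i j

def deg (A : V → V → ℕ) (i : V) : ℕ := outdeg A i

/-- Graph Laplacian: `Δu(i) = -deg(i)·u(i) + Σ_{e incoming to i} u(e⁻)`. -/
def lap (A : V → V → ℕ) (u : V → ℤ) (i : V) : ℤ :=
  -(deg A i : ℤ) * u i + ∑ j, (A j i : ℤ) * u j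

def delta (z : V) : V → ℤ := fun j => if j = z then 1 else 0

/-- Toppling vertex `i`: replace `s` by `s + Δδ_i`. -/
def toppleAt (A : V → V → ℕ) (s : V → ℤ) (i : V) : V → ℤ :=
  fun j => s j + lap A (delta i) j

def applySeq (A : V → V → ℕ) (s : V → ℤ) (l : List V) : V → ℤ :=
  l.foldl (toppleAt A) s

/-- A legal toppling sequence (avoiding the forbidden set `F`): each toppled
vertex is unstable when toppled and does not lie in `F`. -/
def ValidSeq (A : V → V → ℕ) (F : V → Prop) : (V → ℤ) → List V → Prop
  | _, [] => True
  | s, i :: l => ¬ F i ∧ (deg A i : ℤ) ≤ s i ∧ ValidSeq A F (toppleAt A s i) l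

/-- Stable at every non-forbidden vertex. -/
def StableOff (A : V → V → ℕ) (F : V → Prop) (s : V → ℤ) : Prop :=
  ∀ i, ¬ F i → s i ≤ (deg A i : ℤ) - 1

def StabilizesTo (A : V → V → ℕ) (F : V → Prop) (s : V → ℤ) (l : List V) : Prop :=
  ValidSeq A F s l ∧ StableOff A F (applySeq A s l)

def StabilizableVia (A : V → V → ℕ) (F : V → Prop) (s : V → ℤ) : Prop :=
  ∃ l, StabilizesTo A F s l

/-- Stabilizable with no forbidden vertices. -/
def Stabilizable (A : V → V → ℕ) (s : V → ℤ) : Prop :=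
  StabilizableVia A (fun _ => False) s

def stabSeq (A : V → V → ℕ) (F : V → Prop) (s : V → ℤ) : List V :=
  if h : StabilizableVia A F s then h.choose else []

def stabilizeVia (A : V → V → ℕ) (F : V → Prop) (s : V → ℤ) : V → ℤ :=
  applySeq A s (stabSeq A F s)

/-- Odometer: number of topplings at each vertex (`0` everywhere if not stabilizable). -/
def odometerVia (A : V → V → ℕ) (F : V → Prop) (s : V → ℤ) : V → ℕ :=
  fun i => (stabSeq A F s).count i

def sinkStabilize (A : V → V → ℕ) (z : V) (s : V → ℤ) : V → ℤ :=
  stabilizeVia A (fun i => i = z) s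

def sinkOdometer (A : V → V → ℕ) (z : V) (s : V → ℤ) : V → ℕ :=
  odometerVia A (fun i => i = z) s

/-- `ρ` is `z`-recurrent (Dhar's burning test): `ρ(z) = deg z`, `ρ(i) ≤ deg i - 1`
off the sink, and every site other than `z` topples exactly once in the
stabilization of `ρ + Δδ_z` with sink `z`. -/
def ZRec (A : V → V → ℕ) (z : V) (ρ : V → ℤ) : Prop :=
  ρ z = (deg A z : ℤ) ∧ (∀ i, i ≠ z → ρ i ≤ (deg A i : ℤ) - 1) ∧
  ∃ l : List V, StabilizesTo A (fun i => i = z) (fun j => ρ j + lap A (delta z) j) l ∧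
    ∀ i, i ≠ z → l.count i = 1

/-- `κ` = number of `z`-recurrent sandpiles. -/
def kappa (A : V → V → ℕ) (z : V) : ℕ := Nat.card {ρ : V → ℤ // ZRec A z ρ}

def totalMass (s : V → ℤ) : ℤ := ∑ i, s i

/-- Open addition operator `â_i` (with sink `z`). -/
def openAdd (A : V → V → ℕ) (z i : V) (ρ : V → ℤ) : V → ℤ :=
  fun j => if j = z then (deg A z : ℤ) else sinkStabilize A z (fun k => ρ k + delta i k) j

/-- `â_i⁻¹` on `Rec(z)`. -/
def openAddInv (A : V → V → ℕ) (z i : V) (ρ : V → ℤ) : V → ℤ :=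
  if h : ∃ ρ', ZRec A z ρ' ∧ openAdd A z i ρ' = ρ then h.choose else ρ

/-- Burst size `av_{i→z}(ρ) = |â_i⁻¹ρ| - |ρ| + 1`. -/
def burst (A : V → V → ℕ) (z i : V) (ρ : V → ℤ) : ℤ :=
  totalMass (openAddInv A z i ρ) - totalMass ρ + 1

/-- The `z`-recurrent decomposition `s = ρ + m·δ_z + Δv` with `ρ ∈ Rec(z)`, `v(z)=0`. -/
def ZDecomp (A : V → V → ℕ) (z : V) (s ρ : V → ℤ) (m : ℤ) (v : V → ℤ) : Prop :=
  ZRec A z ρ ∧ v z = 0 ∧ ∀ j, s j = ρ j + m * delta z j + lap A v j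

/-- `R_z(s)`: the `z`-recurrent representative of `s`. -/
def Rz (A : V → V → ℕ) (z : V) (s : V → ℤ) : V → ℤ :=
  if h : ∃ ρ, ∃ m, ∃ v, ZDecomp A z s ρ m v then h.choose else s

/-- `m_z(s)`: the integer in the `z`-recurrent decomposition of `s`. -/
def mz (A : V → V → ℕ) (z : V) (s : V → ℤ) : ℤ :=
  if h : ∃ m, ∃ ρ, ∃ v, ZDecomp A z s ρ m v then h.choose else 0

/-- Closed addition operator `a_i`. -/
def closedAdd (A : V → V → ℕ) (i : V) (s : V → ℤ) : V → ℤ :=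
  if Stabilizable A (fun j => s j + delta i j) then
    stabilizeVia A (fun _ => False) (fun j => s j + delta i j)
  else fun j => s j + delta i j

/-- The closed chain after making the additions listed in `w` (in order). -/
def chain (A : V → V → ℕ) (s0 : V → ℤ) (w : List V) : V → ℤ :=
  w.foldl (fun s i => closedAdd A i s) s0

/-- `w` is a threshold word for `s0`: the chain first becomes non-stabilizable
exactly after the additions in `w`, i.e. `τ = |w|` on the cylinder of `w`. -/
def IsThresholdWord (A : V → V → ℕ) (s0 : V → ℤ) (w : List V) : Prop :=
  ¬ Stabilizable A (chain A s0 w) ∧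
  ∀ w' : List V, w' <+: w → w' ≠ w → Stabilizable A (chain A s0 w')

def wordProb (α : V → ℝ) (w : List V) : ℝ := (w.map α).prod

/-- `P_{s0}(E at the threshold time)`: total probability of the (disjoint)
cylinders of threshold words satisfying `E`. -/
def thresholdProb (A : V → V → ℕ) (α : V → ℝ) (s0 : V → ℤ) (E : List V → Prop) : ℝ :=
  ∑' w : List V, if IsThresholdWord A s0 w ∧ E w then wordProb α w else 0

/-- `E_{s0}[f at the threshold time]`. -/
def thresholdExp (A : V → V → ℕ) (α : V → ℝ) (s0 : V → ℤ) (f : List V → ℝ) : ℝ :=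
  ∑' w : List V, if IsThresholdWord A s0 w then wordProb α w * f w else 0

end ThresholdState

set_option linter.unusedSectionVars false

namespace ThresholdState

section Laplacian

variable {V : Type*} [Fintype V] [DecidableEq V] {A : V → V → ℕ} {z : V}

lemma lap_add (u v : V → ℤ) (i : V) : lap A (u + v) i = lap A u i + lap A v i := by
  simp only [lap, Pi.add_apply, mul_add, Finset.sum_add_distrib]
  ring

lemma lap_neg (u : V → ℤ) (i : V) : lap A (-u) i = -lap A u i := by
  simp only [lap, Pi.neg_apply, mul_neg, Finset.sum_neg_distrib]
  ring

lemma lap_sub (u v : V → ℤ) (i : V) : lap A (u - v) i = lap A u i - lap A v i := by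
  rw [sub_eq_add_neg, lap_add, lap_neg, sub_eq_add_neg]

lemma lap_smul (c : ℤ) (u : V → ℤ) (i : V) : lap A (c • u) i = c * lap A u i := by
  simp only [lap, Pi.smul_apply, smul_eq_mul, mul_add, Finset.mul_sum]
  congr 1
  · ring
  · exact Finset.sum_congr rfl fun j _ => by ring

lemma lap_zero (i : V) : lap A 0 i = 0 := by simp [lap]

lemma lap_delta (k i : V) :
    lap A (delta k) i = A k i - if i = k then (deg A i : ℤ) else 0 := by
  simp only [lap, delta, mul_ite, mul_one, mul_zero, Finset.sum_ite_eq', Finset.mem_univ, if_true]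
  split_ifs <;> ring

lemma sum_lap (u : V → ℤ) : ∑ i, lap A u i = 0 := by
  simp only [lap, Finset.sum_add_distrib]
  rw [Finset.sum_comm (f := fun i j => (A j i : ℤ) * u j)]
  simp only [← Finset.sum_mul]
  rw [← Finset.sum_add_distrib]
  refine Finset.sum_eq_zero fun i _ => ?_
  simp [deg, outdeg]

lemma deg_eq_sum_in (hEul : Eulerian A) (i : V) : (deg A i : ℤ) = ∑ j, (A j i : ℤ) := by
  rw [deg, hEul i, indeg]
  push_cast
  rfl

lemma lap_eq_sum (hEul : Eulerian A) (u : V → ℤ) (i : V) :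
    lap A u i = ∑ j, (A j i : ℤ) * (u j - u i) := by
  simp only [lap, mul_sub, Finset.sum_sub_distrib, deg_eq_sum_in hEul, ← Finset.sum_mul]
  ring

lemma lap_sub_const (hEul : Eulerian A) (u : V → ℤ) (c : ℤ) (i : V) :
    lap A (fun j => u j - c) i = lap A u i := by
  simp [lap_eq_sum hEul]

/-- Minimum principle: a function superharmonic off `z` and nonnegative at `z` is nonnegative. -/
lemma nonneg_of_superharmonic {R : Type*} [CommRing R] [LinearOrder R] [IsStrictOrderedRing R]
    (hConn : Connected A) (u : V → R) (hz : 0 ≤ u z)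
    (h : ∀ i, i ≠ z → ∑ j, (A j i : R) * (u j - u i) ≤ 0) (i : V) : 0 ≤ u i := by
  have : Nonempty V := ⟨z⟩
  obtain ⟨k, hk⟩ := Finite.exists_min u
  by_contra! hi
  have hneg : u k < 0 := (hk i).trans_lt hi
  have key : ∀ a, Relation.ReflTransGen (fun a b => 0 < A a b) a k → u a = u k := by
    intro a ha
    induction ha using Relation.ReflTransGen.head_induction_on with
    | refl => rfl
    | @head a b hab _ ih =>
      have hbz : b ≠ z := by
        rintro rfl
        rw [ih] at hz
        exact absurd hz (not_le.2 hneg)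
      have hnn : ∀ j ∈ Finset.univ, 0 ≤ (A j b : R) * (u j - u b) := fun j _ =>
        mul_nonneg (Nat.cast_nonneg _) (sub_nonneg.2 (ih ▸ hk j))
      have h0 := (Finset.sum_eq_zero_iff_of_nonneg hnn).1
        (le_antisymm (h b hbz) (Finset.sum_nonneg hnn)) a (Finset.mem_univ _)
      rcases mul_eq_zero.1 h0 with h1 | h1
      · exact absurd (Nat.cast_eq_zero.1 h1) hab.ne'
      · rw [← ih, sub_eq_zero.1 h1]
  rw [key z (hConn z k)] at hz
  exact absurd hz (not_le.2 hneg)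

/-- The rational Laplacian with Dirichlet boundary condition at `z`. -/
def dirichletLap (A : V → V → ℕ) (z : V) : (V → ℚ) →ₗ[ℚ] (V → ℚ) where
  toFun u i := if i = z then u z else ∑ j, (A j i : ℚ) * (u j - u i)
  map_add' u v := by
    ext i
    simp only [Pi.add_apply]
    split_ifs
    · rfl
    · rw [← Finset.sum_add_distrib]
      exact Finset.sum_congr rfl fun j _ => by ring
  map_smul' c u := by
    ext i
    simp only [Pi.smul_apply, smul_eq_mul, RingHom.id_apply]
    split_ifs
    · rfl
    · rw [Finset.mul_sum]
      exact Finset.sum_congr rfl fun j _ => by ring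

lemma dirichletLap_surjective (hConn : Connected A) :
    Function.Surjective (dirichletLap A z) := by
  have hnn : ∀ u, dirichletLap A z u = 0 → ∀ i, 0 ≤ u i := fun u hu => by
    have h := fun i => congrFun hu i
    simp only [dirichletLap, LinearMap.coe_mk, AddHom.coe_mk, Pi.zero_apply] at h
    refine nonneg_of_superharmonic (z := z) hConn u ?_ fun i hi => ?_
    · simpa using (h z).ge
    · simpa [hi] using (h i).le
  refine LinearMap.injective_iff_surjective.1 ((injective_iff_map_eq_zero _).2 fun u hu => ?_)
  ext i
  refine le_antisymm ?_ (hnn u hu i)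
  have := hnn (-u) (by rw [map_neg, hu, neg_zero]) i
  simpa using this

/-- Up to a positive multiple, every integer function off `z` is a Laplacian. -/
lemma exists_lap_eq_mul (hEul : Eulerian A) (hConn : Connected A) (f : V → ℤ) :
    ∃ N : ℤ, 0 < N ∧ ∃ u : V → ℤ, u z = 0 ∧ ∀ i, i ≠ z → lap A u i = N * f i := by
  obtain ⟨x, hx⟩ := dirichletLap_surjective (z := z) hConn fun i => if i = z then 0 else (f i : ℚ)
  have h := fun i => congrFun hx i
  simp only [dirichletLap, LinearMap.coe_mk, AddHom.coe_mk] at h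
  have hdvd : ∀ i, (x i).den ∣ ∏ j, (x j).den := fun i =>
    Finset.dvd_prod_of_mem (fun j => (x j).den) (Finset.mem_univ i)
  have hint : ∀ i, ∃ n : ℤ, (n : ℚ) = ((∏ j, (x j).den : ℕ) : ℚ) * x i := fun i => by
    obtain ⟨c, hc⟩ := hdvd i
    refine ⟨c * (x i).num, ?_⟩
    rw [hc]
    push_cast
    rw [mul_right_comm, mul_comm (((x i).den : ℚ)), Rat.mul_den_eq_num, mul_comm]
  choose u hu using hint
  refine ⟨(∏ j, (x j).den : ℕ), ?_, u, ?_, fun i hi => ?_⟩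
  · exact_mod_cast Finset.prod_pos fun j _ => (x j).den_pos
  · have h1 := h z
    simp only [if_true] at h1
    have h2 := hu z
    rw [h1, mul_zero] at h2
    exact_mod_cast h2
  · have h1 := h i
    simp only [if_neg hi] at h1
    rw [lap_eq_sum hEul]
    have : ((∑ j, (A j i : ℤ) * (u j - u i) : ℤ) : ℚ)
        = (((∏ j, (x j).den : ℕ) : ℤ) * f i : ℤ) := by
      rw [Int.cast_mul, ← h1, Finset.mul_sum]
      push_cast [hu]
      exact Finset.sum_congr rfl fun j _ => by ring
    exact_mod_cast this

/-- A strictly superharmonic (off `z`) nonnegative integer function vanishing at `z`. -/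
lemma exists_superharmonic (hEul : Eulerian A) (hConn : Connected A) (z : V) :
    ∃ w : V → ℤ, w z = 0 ∧ (∀ i, 0 ≤ w i) ∧ ∀ i, i ≠ z → lap A w i ≤ -1 := by
  obtain ⟨N, hN, w, hwz, hw⟩ := exists_lap_eq_mul (z := z) hEul hConn fun _ => -1
  refine ⟨w, hwz, ?_, fun i hi => by rw [hw i hi]; linarith⟩
  refine nonneg_of_superharmonic (z := z) hConn w hwz.ge fun i hi => ?_
  have := hw i hi
  rw [lap_eq_sum hEul] at this
  linarith

end Laplacian

section Toppling

variable {V : Type*} [Fintype V] [DecidableEq V] {A : V → V → ℕ} {F : V → Prop}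

lemma applySeq_apply (s : V → ℤ) (l : List V) (j : V) :
    applySeq A s l j = s j + lap A (fun i => (l.count i : ℤ)) j := by
  induction l generalizing s with
  | nil => simp [applySeq, lap]
  | cons i l ih =>
    have h : (fun k => ((i :: l).count k : ℤ)) = (fun k => (l.count k : ℤ)) + delta i := by
      ext k
      by_cases hk : k = i
      · subst hk; simp [delta]
      · simp [delta, hk, List.count_cons_of_ne (Ne.symm hk)]
    have h2 : applySeq A s (i :: l) = applySeq A (toppleAt A s i) l := rfl
    rw [h2, ih, h, lap_add, toppleAt]
    ring

/-- Least action principle, in the form of a bound on the number of legal topplings. -/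
lemma length_le_of_validSeq {s : V → ℤ} {l : List V} (hl : ValidSeq A F s l) {u : V → ℤ}
    (hu : ∀ i, 0 ≤ u i) (hs : StableOff A F fun j => s j + lap A u j) :
    (l.length : ℤ) ≤ ∑ i, u i := by
  induction l generalizing s u with
  | nil => simpa using Finset.sum_nonneg fun i _ => hu i
  | cons i l ih =>
    obtain ⟨hFi, hdeg, hl⟩ := hl
    have hui : 1 ≤ u i := by
      by_contra! hlt
      have h0 : u i = 0 := by have := hu i; omega
      have h1 := hs i hFi
      have h2 : 0 ≤ lap A u i := by
        simp only [lap, h0, mul_zero, zero_add]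
        exact Finset.sum_nonneg fun j _ => mul_nonneg (Nat.cast_nonneg _) (hu j)
      simp only at h1
      omega
    have hu' : ∀ j, 0 ≤ (u - delta i) j := fun j => by
      simp only [Pi.sub_apply, delta]
      split_ifs with h
      · subst h; omega
      · simpa using hu j
    have h3 := ih hl hu' (fun j hj => by
      have := hs j hj
      simp only [toppleAt, lap_sub] at this ⊢
      linarith)
    have h4 : ∑ j, (u - delta i) j = ∑ j, u j - 1 := by
      simp [delta, Finset.sum_sub_distrib]
    rw [h4] at h3
    push_cast [List.length_cons]
    linarith

lemma stabilizableVia_or_exists_validSeq (s : V → ℤ) (n : ℕ) :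
    StabilizableVia A F s ∨ ∃ l, ValidSeq A F s l ∧ l.length = n := by
  induction n generalizing s with
  | zero => exact .inr ⟨[], trivial, rfl⟩
  | succ n ih =>
    by_cases hs : StableOff A F s
    · exact .inl ⟨[], trivial, hs⟩
    · simp only [StableOff, not_forall] at hs
      obtain ⟨i, hi, hlt⟩ := hs
      have hdeg : (deg A i : ℤ) ≤ s i := by omega
      rcases ih (toppleAt A s i) with ⟨l, hl1, hl2⟩ | ⟨l, hl, hlen⟩
      · exact .inl ⟨i :: l, ⟨hi, hdeg, hl1⟩, hl2⟩
      · exact .inr ⟨i :: l, ⟨hi, hdeg, hl⟩, by simp [hlen]⟩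

lemma stabilizableVia_of_exists {s u : V → ℤ} (hu : ∀ i, 0 ≤ u i)
    (hs : StableOff A F fun j => s j + lap A u j) : StabilizableVia A F s := by
  refine (stabilizableVia_or_exists_validSeq s ((∑ i, u i).toNat + 1)).resolve_right ?_
  rintro ⟨l, hl, hlen⟩
  have := length_le_of_validSeq hl hu hs
  omega

lemma stabilizable_iff (hEul : Eulerian A) (s : V → ℤ) :
    Stabilizable A s ↔ ∃ u : V → ℤ, ∀ i, s i + lap A u i ≤ deg A i - 1 := by
  constructor
  · rintro ⟨l, -, hl⟩
    exact ⟨_, fun i => applySeq_apply s l i ▸ hl i not_false⟩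
  · rintro ⟨u, hu⟩
    rcases isEmpty_or_nonempty V with _ | _
    · exact ⟨[], trivial, fun i => isEmptyElim i⟩
    · obtain ⟨k, hk⟩ := Finite.exists_min u
      refine stabilizableVia_of_exists (u := fun j => u j - u k) (fun i => by simpa using hk i)
        fun i _ => ?_
      simpa only [lap_sub_const hEul] using hu i

lemma stabilizable_add_lap_iff (hEul : Eulerian A) (s v : V → ℤ) :
    Stabilizable A (fun j => s j + lap A v j) ↔ Stabilizable A s := by
  rw [stabilizable_iff hEul, stabilizable_iff hEul]
  constructor
  · rintro ⟨u, hu⟩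
    exact ⟨v + u, fun i => by rw [lap_add]; linarith [hu i]⟩
  · rintro ⟨u, hu⟩
    exact ⟨u - v, fun i => by rw [lap_sub]; linarith [hu i]⟩

lemma Stabilizable.mono (hEul : Eulerian A) {s t : V → ℤ} (hst : ∀ i, s i ≤ t i)
    (ht : Stabilizable A t) : Stabilizable A s := by
  rw [stabilizable_iff hEul] at ht ⊢
  exact ht.imp fun u hu i => by linarith [hu i, hst i]

lemma stabilizeVia_spec {s : V → ℤ} (h : StabilizableVia A F s) :
    StabilizesTo A F s (stabSeq A F s) := by
  rw [stabSeq, dif_pos h]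
  exact h.choose_spec

end Toppling

section Recurrent

variable {V : Type*} [Fintype V] [DecidableEq V] {A : V → V → ℕ} {z : V}

/-- No set of sites avoiding `z` is a forbidden subconfiguration of `s`. -/
def NoForbidden (A : V → V → ℕ) (z : V) (s : V → ℤ) : Prop :=
  ∀ X : Finset V, X.Nonempty → z ∉ X → ∃ i ∈ X, (deg A i : ℤ) ≤ s i + ∑ j ∈ Xᶜ, (A j i : ℤ)

lemma NoForbidden.mono {s t : V → ℤ} (hs : NoForbidden A z s) (hst : ∀ i, i ≠ z → s i ≤ t i) :
    NoForbidden A z t := fun X hX hz => by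
  obtain ⟨i, hi, h⟩ := hs X hX hz
  exact ⟨i, hi, h.trans (by linarith [hst i fun h' => hz (h' ▸ hi)])⟩

/-- Subtracting `Δu` from a sandpile without forbidden subconfigurations leaves an unstable
site where `u` is maximal, unless `u` is maximal at `z`. -/
lemma NoForbidden.exists_unstable (hEul : Eulerian A) {s : V → ℤ} (hs : NoForbidden A z s)
    (u : V → ℤ) {k : V} (hk : u z < u k) : ∃ i, i ≠ z ∧ (deg A i : ℤ) ≤ s i - lap A u i := by
  have hne : Nonempty V := ⟨z⟩
  obtain ⟨b, hb⟩ := Finite.exists_max u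
  obtain ⟨i, hi, h⟩ := hs (Finset.univ.filter fun i => u i = u b) ⟨b, by simp⟩
    (by simp only [Finset.mem_filter, Finset.mem_univ, true_and]; have := hb k; omega)
  simp only [Finset.mem_filter, Finset.mem_univ, true_and] at hi
  refine ⟨i, ?_, h.trans ?_⟩
  · rintro rfl
    have := hb k
    omega
  · rw [lap_eq_sum hEul, sub_eq_add_neg, ← Finset.sum_neg_distrib]
    gcongr
    refine (Finset.sum_le_sum fun j hj => ?_).trans
      (Finset.sum_le_sum_of_subset_of_nonneg (Finset.subset_univ _) fun j _ _ => ?_)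
    · simp only [Finset.mem_compl, Finset.mem_filter, Finset.mem_univ, true_and] at hj
      have h1 : u j - u i ≤ -1 := by have := hb j; omega
      nlinarith [Int.natCast_nonneg (A j i)]
    · have h1 : u j - u i ≤ 0 := by have := hb j; omega
      nlinarith [Int.natCast_nonneg (A j i)]

/-- Legal topplings away from the sink do not create forbidden subconfigurations. -/
lemma NoForbidden.toppleAt (hEul : Eulerian A) {s : V → ℤ} (hs : NoForbidden A z s) {k : V}
    (hk : (deg A k : ℤ) ≤ s k) : NoForbidden A z (toppleAt A s k) := by
  intro X hX hz
  simp only [ThresholdState.toppleAt, lap_delta]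
  by_cases hkX : k ∈ X
  · by_cases hne : (X.erase k).Nonempty
    · obtain ⟨i, hi, h⟩ := hs _ hne fun h => hz (Finset.mem_of_mem_erase h)
      refine ⟨i, Finset.mem_of_mem_erase hi, ?_⟩
      rw [Finset.compl_erase, Finset.sum_insert (by simpa using hkX)] at h
      rw [if_neg (Finset.ne_of_mem_erase hi)]
      linarith
    · obtain rfl : X = {k} := by
        refine Finset.eq_singleton_iff_unique_mem.2 ⟨hkX, fun i hi => ?_⟩
        by_contra hik
        exact hne ⟨i, Finset.mem_erase.2 ⟨hik, hi⟩⟩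
      refine ⟨k, hkX, ?_⟩
      have h2 := deg_eq_sum_in hEul k
      rw [← Finset.sum_add_sum_compl {k}, Finset.sum_singleton] at h2
      rw [if_pos rfl]
      linarith
  · obtain ⟨i, hi, h⟩ := hs X hX hz
    refine ⟨i, hi, ?_⟩
    rw [if_neg fun h' : i = k => hkX (h' ▸ hi)]
    linarith [Int.natCast_nonneg (A k i)]

lemma NoForbidden.applySeq (hEul : Eulerian A) {F : V → Prop} {s : V → ℤ}
    (hs : NoForbidden A z s) {l : List V} (hl : ValidSeq A F s l) :
    NoForbidden A z (applySeq A s l) := by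
  induction l generalizing s with
  | nil => exact hs
  | cons i l ih => exact ih (hs.toppleAt hEul hl.2.1) hl.2.2

lemma validSeq_append {F : V → Prop} {s : V → ℤ} {l l' : List V} :
    ValidSeq A F s (l ++ l') ↔ ValidSeq A F s l ∧ ValidSeq A F (applySeq A s l) l' := by
  induction l generalizing s with
  | nil => simp [ValidSeq, ThresholdState.applySeq]
  | cons i l ih =>
    simp only [List.cons_append, ValidSeq, ih, and_assoc]
    rfl

lemma ValidSeq.not_mem {F : V → Prop} {s : V → ℤ} {l : List V} (hl : ValidSeq A F s l)
    {i : V} (hi : i ∈ l) : ¬F i := by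
  induction l generalizing s with
  | nil => simp at hi
  | cons k l ih =>
    rcases List.mem_cons.1 hi with rfl | hi
    · exact hl.1
    · exact ih hl.2.2 hi

/-- The sandpile at `i` after toppling `z` and the sites of a duplicate-free list. -/
lemma applySeq_burn {s : V → ℤ} {l : List V} (hl : l.Nodup) (hz : z ∉ l) {i : V} (hi : i ∉ l)
    (hiz : i ≠ z) : applySeq A (fun j => s j + lap A (delta z) j) l i
      = s i + ∑ j ∈ insert z l.toFinset, (A j i : ℤ) := by
  rw [applySeq_apply, lap_delta, if_neg hiz, Finset.sum_insert (by simpa using hz)]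
  have : ∑ j, (A j i : ℤ) * (l.count j : ℤ) = ∑ j ∈ l.toFinset, (A j i : ℤ) := by
    rw [← Finset.sum_subset (Finset.subset_univ l.toFinset)]
    · exact Finset.sum_congr rfl fun j hj => by
        simp [List.count_eq_one_of_mem hl (List.mem_toFinset.1 hj)]
    · intro j _ hj
      simp [List.count_eq_zero_of_not_mem fun h => hj (List.mem_toFinset.2 h)]
  simp only [lap, List.count_eq_zero_of_not_mem hi, this]
  push_cast
  ring

lemma exists_burn {s : V → ℤ} (hs : NoForbidden A z s) (n : ℕ)
    (hn : n < Fintype.card V) :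
    ∃ l : List V, l.length = n ∧ l.Nodup ∧
      ValidSeq A (fun i => i = z) (fun j => s j + lap A (delta z) j) l := by
  induction n with
  | zero => exact ⟨[], rfl, List.nodup_nil, trivial⟩
  | succ n ih =>
    obtain ⟨l, hlen, hnd, hval⟩ := ih (by omega)
    have hzl : z ∉ l := fun h => hval.not_mem h rfl
    have hcard : (insert z l.toFinset).card = n + 1 := by
      rw [Finset.card_insert_of_notMem (by simpa using hzl), List.toFinset_card_of_nodup hnd, hlen]
    obtain ⟨i, hi, h⟩ := hs (insert z l.toFinset)ᶜ
      (by rw [← Finset.card_pos, Finset.card_compl]; omega) (by simp)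
    simp only [Finset.mem_compl, Finset.mem_insert, List.mem_toFinset, not_or] at hi
    refine ⟨l ++ [i], by simp [hlen], ?_, validSeq_append.2 ⟨hval, hi.1, ?_, trivial⟩⟩
    · exact List.nodup_append.2 ⟨hnd, List.nodup_singleton i, by
        rintro a ha b hb rfl
        exact hi.2 (List.mem_singleton.1 hb ▸ ha)⟩
    · rwa [applySeq_burn hnd hzl hi.2 hi.1, ← compl_compl (insert z l.toFinset)]

/-- Dhar's burning test: recurrence is the absence of forbidden subconfigurations. -/
lemma zrec_iff (hEul : Eulerian A) {ρ : V → ℤ} : ZRec A z ρ ↔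
    ρ z = deg A z ∧ (∀ i, i ≠ z → ρ i ≤ (deg A i : ℤ) - 1) ∧ NoForbidden A z ρ := by
  refine and_congr_right fun _ => and_congr_right fun hst => ⟨?_, fun h => ?_⟩
  · rintro ⟨l, ⟨hval, -⟩, hcount⟩ X hX hzX
    have hnd : l.Nodup := List.nodup_iff_count_le_one.2 fun i => by
      by_cases hi : i = z
      · rw [List.count_eq_zero_of_not_mem fun h => hval.not_mem h hi]
        exact zero_le_one
      · exact (hcount i hi).le
    obtain ⟨x, hx⟩ := hX
    have hxl : x ∈ l := List.count_pos_iff.1 (by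
      rw [hcount x fun h => hzX (h ▸ hx)]
      exact one_pos)
    obtain ⟨i, l₁, l₂, hi, rfl, hl₁⟩ :
        ∃ i l₁ l₂, i ∈ X ∧ l = l₁ ++ i :: l₂ ∧ ∀ j ∈ l₁, j ∉ X := by
      clear hval hcount hnd
      induction l with
      | nil => simp at hxl
      | cons k l ih =>
        by_cases hk : k ∈ X
        · exact ⟨k, [], l, hk, rfl, by simp⟩
        · obtain ⟨i, l₁, l₂, hi, rfl, h⟩ := ih ((List.mem_cons.1 hxl).resolve_left
            fun h => hk (h ▸ hx))
          exact ⟨i, k :: l₁, l₂, hi, rfl, by simpa [hk] using h⟩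
    have hv := validSeq_append.1 hval
    refine ⟨i, hi, hv.2.2.1.trans ?_⟩
    rw [applySeq_burn (List.nodup_append.1 hnd).1 (fun h => hv.1.not_mem h rfl)
      (fun h => hl₁ i h hi) fun h => hzX (h ▸ hi)]
    refine add_le_add_right (Finset.sum_le_sum_of_subset_of_nonneg (fun j hj => ?_)
      fun j _ _ => Int.natCast_nonneg _) _
    rcases Finset.mem_insert.1 hj with rfl | hj
    · simpa using hzX
    · simpa using hl₁ j (List.mem_toFinset.1 hj)
  · have hpos : 0 < Fintype.card V := Fintype.card_pos_iff.2 ⟨z⟩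
    obtain ⟨l, hlen, hnd, hval⟩ := exists_burn h (Fintype.card V - 1) (by omega)
    have hzl : z ∉ l := fun h => hval.not_mem h rfl
    have huniv : insert z l.toFinset = Finset.univ := by
      rw [← Finset.card_eq_iff_eq_univ, Finset.card_insert_of_notMem (by simpa using hzl),
        List.toFinset_card_of_nodup hnd]
      omega
    have hcount : ∀ i, i ≠ z → l.count i = 1 := fun i hi => by
      have := huniv ▸ Finset.mem_univ i
      exact List.count_eq_one_of_mem hnd (by simpa [hi] using this)
    refine ⟨l, ⟨hval, fun i hi => ?_⟩, hcount⟩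
    have h1 : (fun i => (l.count i : ℤ)) = fun j => (1 : ℤ) - delta z j := by
      ext j
      by_cases hj : j = z
      · simp [hj, delta, List.count_eq_zero_of_not_mem hzl]
      · simp [hj, delta, hcount j hj]
    have h2 : lap A (fun j => (1 : ℤ) - delta z j) i = - lap A (delta z) i := by
      rw [lap_eq_sum hEul, lap_eq_sum hEul, ← Finset.sum_neg_distrib]
      exact Finset.sum_congr rfl fun j _ => by ring
    rw [applySeq_apply, h1, h2]
    linarith [hst i hi]

/-- A function whose Laplacian takes a sandpile without forbidden subconfigurations to a stable
one is nonnegative, if it vanishes at the sink. -/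
lemma NoForbidden.nonneg_of_stable (hEul : Eulerian A) {s v : V → ℤ} (hs : NoForbidden A z s)
    (hvz : v z = 0) (hst : ∀ i, i ≠ z → s i + lap A v i ≤ deg A i - 1) (i : V) : 0 ≤ v i := by
  by_contra! hi
  obtain ⟨k, hk, h⟩ := hs.exists_unstable hEul (-v) (k := i) (by simpa [hvz] using hi)
  rw [lap_neg] at h
  linarith [hst k hk]

lemma exists_stable_noForbidden (hEul : Eulerian A) (hConn : Connected A) (z : V) (s : V → ℤ) :
    ∃ v : V → ℤ, v z = 0 ∧ (∀ i, i ≠ z → s i + lap A v i ≤ deg A i - 1) ∧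
      NoForbidden A z fun j => s j + lap A v j := by
  obtain ⟨w, hwz, hw0, hw⟩ := exists_superharmonic hEul hConn z
  obtain ⟨B, hB0, hB⟩ : ∃ B : ℤ, 0 ≤ B ∧ ∀ i, |deg A i - 1 - s i| ≤ B := by
    refine ⟨∑ i, |deg A i - 1 - s i|, Finset.sum_nonneg fun i _ => abs_nonneg _, fun i => ?_⟩
    exact Finset.single_le_sum (f := fun i => |(deg A i : ℤ) - 1 - s i|)
      (fun j _ => abs_nonneg _) (Finset.mem_univ i)
  let P : ℤ → Prop := fun n => ∃ v : V → ℤ, v z = 0 ∧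
    (∀ i, i ≠ z → s i + lap A v i ≤ deg A i - 1) ∧ ∑ i, v i = n
  have hinh : ∃ n, P n := by
    refine ⟨_, B • w, by simp [hwz], fun i hi => ?_, rfl⟩
    rw [lap_smul]
    nlinarith [hw i hi, neg_abs_le ((deg A i : ℤ) - 1 - s i), hB i]
  have hbdd : ∀ n, P n → -∑ i, (B • w) i ≤ n := by
    rintro n ⟨v, hvz, hv, rfl⟩
    rw [neg_le_iff_add_nonneg, ← Finset.sum_add_distrib]
    refine Finset.sum_nonneg fun i _ => ?_
    refine nonneg_of_superharmonic (z := z) hConn (v + B • w) (by simp [hvz, hwz]) (fun k hk => ?_) i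
    have := lap_eq_sum hEul (v + B • w) k
    rw [lap_add, lap_smul] at this
    have h : ∑ j, (A j k : ℤ) * ((v + B • w) j - (v + B • w) k) ≤ 0 := by
      rw [← this]
      nlinarith [hw k hk, hv k hk, le_abs_self ((deg A k : ℤ) - 1 - s k), hB k]
    exact_mod_cast h
  obtain ⟨n, ⟨v, hvz, hv, rfl⟩, hmin⟩ := Int.exists_least_of_bdd ⟨_, hbdd⟩ hinh
  refine ⟨v, hvz, hv, ?_⟩
  by_contra hforb
  simp only [NoForbidden, not_forall, not_exists, not_and, not_le] at hforb
  obtain ⟨X, hX, hzX, hforb⟩ := hforb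
  have hsum := hmin _ ⟨v - fun j => if j ∈ X then 1 else 0, by simp [hvz, hzX], fun i hi => ?_, rfl⟩
  · have : 0 < X.card := hX.card_pos
    simp only [Pi.sub_apply, Finset.sum_sub_distrib, Finset.sum_ite_mem, Finset.univ_inter,
      Finset.sum_const, nsmul_eq_mul, mul_one] at hsum
    omega
  · rw [lap_sub]
    by_cases hiX : i ∈ X
    · have h1 : lap A (fun j => if j ∈ X then 1 else 0) i = -∑ j ∈ Xᶜ, (A j i : ℤ) := by
        rw [lap_eq_sum hEul, ← Finset.sum_add_sum_compl X, Finset.sum_eq_zero, zero_add,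
          ← Finset.sum_neg_distrib]
        · refine Finset.sum_congr rfl fun j hj => ?_
          simp [hiX, Finset.mem_compl.1 hj]
        · intro j hj
          simp [hiX, hj]
      linarith [hforb i hiX]
    · have h1 : 0 ≤ lap A (fun j => if j ∈ X then 1 else 0) i := by
        rw [lap_eq_sum hEul]
        refine Finset.sum_nonneg fun j _ => ?_
        simp only [hiX, if_false, sub_zero]
        split_ifs <;> simp
      linarith [hv i hi]

end Recurrent

section Decomposition

variable {V : Type*} [Fintype V] [DecidableEq V] {A : V → V → ℕ} {z : V}

lemma exists_zdecomp (hEul : Eulerian A) (hConn : Connected A) (z : V) (s : V → ℤ) :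
    ∃ ρ m v, ZDecomp A z s ρ m v := by
  obtain ⟨v, hvz, hv, hforb⟩ := exists_stable_noForbidden hEul hConn z s
  refine ⟨fun j => if j = z then (deg A z : ℤ) else s j + lap A v j, s z + lap A v z - deg A z, -v,
    (zrec_iff hEul).2 ⟨by simp, fun i hi => by simpa [hi] using hv i hi,
      hforb.mono fun i hi => by simp [hi]⟩, by simp [hvz], fun j => ?_⟩
  rw [lap_neg]
  by_cases hj : j = z
  · subst hj; simp [delta]
  · simp [delta, hj]

lemma ZDecomp.unique (hEul : Eulerian A) {s ρ ρ' v v' : V → ℤ} {m m' : ℤ}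
    (h : ZDecomp A z s ρ m v) (h' : ZDecomp A z s ρ' m' v') : ρ = ρ' ∧ m = m' := by
  obtain ⟨hρ, hv, hs⟩ := h
  obtain ⟨hρ', hv', hs'⟩ := h'
  rw [zrec_iff hEul] at hρ hρ'
  have hd : ∀ i, i ≠ z → delta z i = 0 := fun i hi => by simp [delta, hi]
  have h1 := hρ.2.2.nonneg_of_stable hEul (v := v - v') (by simp [hv, hv']) fun i hi => by
    have := hs i
    have := hs' i
    simp only [hd i hi] at *
    rw [lap_sub]
    linarith [hρ'.2.1 i hi]
  have h2 := hρ'.2.2.nonneg_of_stable hEul (v := v' - v) (by simp [hv, hv']) fun i hi => by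
    have := hs i
    have := hs' i
    simp only [hd i hi] at *
    rw [lap_sub]
    linarith [hρ.2.1 i hi]
  obtain rfl : v = v' := funext fun i => by
    have := h1 i
    have := h2 i
    simp only [Pi.sub_apply] at *
    omega
  have hm : m = m' := by
    have := hs z
    have := hs' z
    simp only [hρ.1, hρ'.1, delta, if_true] at *
    linarith
  refine ⟨funext fun i => ?_, hm⟩
  subst hm
  linarith [hs i, hs' i]

lemma ZDecomp.mz_eq (hEul : Eulerian A) {s ρ v : V → ℤ} {m : ℤ} (h : ZDecomp A z s ρ m v) :
    mz A z s = m := by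
  have hex : ∃ m, ∃ ρ, ∃ v, ZDecomp A z s ρ m v := ⟨m, ρ, v, h⟩
  rw [mz, dif_pos hex]
  obtain ⟨_, _, h'⟩ := hex.choose_spec
  exact (h'.unique hEul h).2

lemma ZDecomp.Rz_eq (hEul : Eulerian A) {s ρ v : V → ℤ} {m : ℤ} (h : ZDecomp A z s ρ m v) :
    Rz A z s = ρ := by
  have hex : ∃ ρ, ∃ m, ∃ v, ZDecomp A z s ρ m v := ⟨ρ, m, v, h⟩
  rw [Rz, dif_pos hex]
  obtain ⟨_, _, h'⟩ := hex.choose_spec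
  exact (h'.unique hEul h).1

lemma zdecomp_Rz_mz (hEul : Eulerian A) (hConn : Connected A) (z : V) (s : V → ℤ) :
    ∃ v, ZDecomp A z s (Rz A z s) (mz A z s) v := by
  obtain ⟨ρ, m, v, h⟩ := exists_zdecomp hEul hConn z s
  exact ⟨v, by rwa [h.Rz_eq hEul, h.mz_eq hEul]⟩

lemma ZDecomp.totalMass_eq {s ρ v : V → ℤ} {m : ℤ} (h : ZDecomp A z s ρ m v) :
    totalMass s = totalMass ρ + m := by
  simp only [totalMass, h.2.2, Finset.sum_add_distrib, sum_lap, delta, mul_ite, mul_one, mul_zero,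
    Finset.sum_ite_eq', Finset.mem_univ, if_true, add_zero]

/-- A sandpile is stabilizable exactly when `m_z` is negative. -/
lemma ZDecomp.stabilizable_iff (hEul : Eulerian A) {s ρ v : V → ℤ} {m : ℤ}
    (h : ZDecomp A z s ρ m v) : Stabilizable A s ↔ m < 0 := by
  obtain ⟨hρ, hv, hs⟩ := h
  rw [zrec_iff hEul] at hρ
  rw [ThresholdState.stabilizable_iff hEul]
  constructor
  · rintro ⟨u, hu⟩
    by_contra! hm
    have hst : ∀ i, ρ i + lap A (v + u) i ≤ deg A i - 1 := fun i => by
      have h0 : 0 ≤ m * delta z i := by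
        simp only [delta]
        split_ifs <;> simp [hm]
      rw [lap_add]
      linarith [hu i, hs i]
    by_cases hk : ∃ k, (-(v + u)) z < (-(v + u)) k
    · obtain ⟨k, hk⟩ := hk
      obtain ⟨i, -, hi⟩ := hρ.2.2.exists_unstable hEul _ hk
      rw [lap_neg] at hi
      linarith [hst i]
    · simp only [Pi.neg_apply, neg_lt_neg_iff, not_exists, not_lt] at hk
      have h0 : 0 ≤ lap A (v + u) z := by
        rw [lap_eq_sum hEul]
        exact Finset.sum_nonneg fun j _ => mul_nonneg (Int.natCast_nonneg _) (sub_nonneg.2 (hk j))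
      linarith [hst z, hρ.1]
  · refine fun hm => ⟨-v, fun i => ?_⟩
    rw [hs i, lap_neg]
    by_cases hi : i = z
    · subst hi
      simp only [delta, if_true]
      linarith [hρ.1]
    · simp only [delta, hi, if_false]
      linarith [hρ.2.1 i hi]

lemma mz_eq_sub (hEul : Eulerian A) (hConn : Connected A) (z : V) (s : V → ℤ) :
    mz A z s = totalMass s - totalMass (Rz A z s) := by
  obtain ⟨v, h⟩ := zdecomp_Rz_mz hEul hConn z s
  linarith [h.totalMass_eq]

lemma stabilizable_iff_mz_neg (hEul : Eulerian A) (hConn : Connected A) (z : V) (s : V → ℤ) :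
    Stabilizable A s ↔ mz A z s < 0 := by
  obtain ⟨v, h⟩ := zdecomp_Rz_mz hEul hConn z s
  exact h.stabilizable_iff hEul

/-- The subgroup generated by `δ_z` and the image of the Laplacian. -/
def sandSubgroup (A : V → V → ℕ) (z : V) : AddSubgroup (V → ℤ) where
  carrier := {s | ∃ (m : ℤ) (v : V → ℤ), ∀ j, s j = m * delta z j + lap A v j}
  zero_mem' := ⟨0, 0, fun j => by simp [lap_zero]⟩
  add_mem' := by
    rintro s t ⟨m, v, h⟩ ⟨m', v', h'⟩
    refine ⟨m + m', v + v', fun j => ?_⟩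
    rw [Pi.add_apply, h, h', lap_add]
    ring
  neg_mem' := by
    rintro s ⟨m, v, h⟩
    refine ⟨-m, -v, fun j => ?_⟩
    rw [Pi.neg_apply, h, lap_neg]
    ring

/-- The sandpile group with sink `z`. -/
abbrev SandGroup (A : V → V → ℕ) (z : V) : Type _ := (V → ℤ) ⧸ sandSubgroup A z

lemma mk_eq_mk_iff (s t : V → ℤ) : (s : SandGroup A z) = t ↔
    ∃ (m : ℤ) (v : V → ℤ), ∀ j, t j = s j + m * delta z j + lap A v j := by
  rw [QuotientAddGroup.eq]
  refine exists_congr fun m => exists_congr fun v => forall_congr' fun j => ?_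
  rw [Pi.add_apply, Pi.neg_apply]
  constructor <;> intro h <;> linarith

lemma finite_sandGroup (hEul : Eulerian A) (hConn : Connected A) (z : V) :
    Finite (SandGroup A z) := by
  refine AddCommGroup.finite_of_fg_isAddTorsion _ fun x => ?_
  induction x using QuotientAddGroup.induction_on with
  | H s =>
    obtain ⟨N, hN, u, -, hu⟩ := exists_lap_eq_mul (z := z) hEul hConn s
    rw [isOfFinAddOrder_iff_zsmul_eq_zero]
    refine ⟨N, hN.ne', ?_⟩
    rw [← QuotientAddGroup.mk_zsmul, QuotientAddGroup.eq_zero_iff]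
    refine ⟨N * s z - lap A u z, u, fun j => ?_⟩
    by_cases hj : j = z
    · subst hj; simp [delta]
    · simp [delta, hj, hu j hj]

lemma Rz_eq_iff (hEul : Eulerian A) (hConn : Connected A) {s ρ : V → ℤ} (hρ : ZRec A z ρ) :
    Rz A z s = ρ ↔ (s : SandGroup A z) = ρ := by
  constructor
  · rintro rfl
    obtain ⟨v, h⟩ := zdecomp_Rz_mz hEul hConn z s
    exact ((mk_eq_mk_iff _ _).2 ⟨_, _, h.2.2⟩).symm
  · intro h
    obtain ⟨m, v, h⟩ := (mk_eq_mk_iff _ _).1 h.symm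
    refine ZDecomp.Rz_eq (m := m) (v := fun j => v j - v z) hEul ⟨hρ, sub_self _, fun j => ?_⟩
    rw [lap_sub_const hEul, h]

lemma zrec_Rz (hEul : Eulerian A) (hConn : Connected A) (z : V) (s : V → ℤ) :
    ZRec A z (Rz A z s) := by
  obtain ⟨v, h⟩ := zdecomp_Rz_mz hEul hConn z s
  exact h.1

lemma mk_Rz (hEul : Eulerian A) (hConn : Connected A) (z : V) (s : V → ℤ) :
    (s : SandGroup A z) = Rz A z s :=
  (Rz_eq_iff hEul hConn (zrec_Rz hEul hConn z s)).1 rfl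

lemma ZRec.eq_of_mk_eq (hEul : Eulerian A) (hConn : Connected A) {ρ ρ' : V → ℤ}
    (hρ : ZRec A z ρ) (hρ' : ZRec A z ρ') (h : (ρ : SandGroup A z) = ρ') : ρ = ρ' := by
  rw [← (Rz_eq_iff hEul hConn hρ').2 h, (Rz_eq_iff hEul hConn hρ).2 rfl]

lemma kappa_eq_card (hEul : Eulerian A) (hConn : Connected A) (z : V) :
    kappa A z = Nat.card (SandGroup A z) := by
  refine Nat.card_congr (Equiv.ofBijective (fun ρ => (ρ.1 : SandGroup A z)) ⟨?_, fun x => ?_⟩)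
  · exact fun ρ ρ' h => Subtype.ext (ρ.2.eq_of_mk_eq hEul hConn ρ'.2 h)
  · induction x using QuotientAddGroup.induction_on with
    | H s => exact ⟨⟨Rz A z s, zrec_Rz hEul hConn z s⟩, (mk_Rz hEul hConn z s).symm⟩

lemma openAdd_spec (hEul : Eulerian A) (hConn : Connected A) {ρ : V → ℤ} (hρ : ZRec A z ρ)
    (i : V) : ZRec A z (openAdd A z i ρ) ∧
      (openAdd A z i ρ : SandGroup A z) = (ρ : SandGroup A z) + (delta i : V → ℤ) := by
  set t : V → ℤ := fun k => ρ k + delta i k with ht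
  have hstab : StabilizableVia A (fun k => k = z) t := by
    obtain ⟨w, hwz, hw0, hw⟩ := exists_superharmonic hEul hConn z
    refine stabilizableVia_of_exists hw0 fun k hk => ?_
    have h1 : delta i k ≤ 1 := by
      simp only [delta]
      split_ifs <;> simp
    have := ((zrec_iff hEul).1 hρ).2.1 k hk
    have := hw k hk
    simp only [ht]
    linarith
  obtain ⟨hval, hst⟩ := stabilizeVia_spec hstab
  have hforb : NoForbidden A z t := ((zrec_iff hEul).1 hρ).2.2.mono fun k _ => by
    simp only [ht, delta]
    split_ifs <;> simp
  have hval' := hforb.applySeq hEul hval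
  have hne : ∀ k, k ≠ z → openAdd A z i ρ k
      = applySeq A t (stabSeq A (fun k => k = z) t) k := fun k hk => by
    simp [openAdd, hk, sinkStabilize, stabilizeVia, ht]
  have hz : openAdd A z i ρ z = deg A z := by simp [openAdd]
  refine ⟨(zrec_iff hEul).2 ⟨hz, fun k hk => ?_, hval'.mono fun k hk => (hne k hk).ge⟩, ?_⟩
  · rw [hne k hk]
    exact hst k hk
  · rw [← QuotientAddGroup.mk_add, eq_comm, mk_eq_mk_iff]
    refine ⟨deg A z - applySeq A t (stabSeq A (fun k => k = z) t) z,
      fun k => ((stabSeq A (fun k => k = z) t).count k : ℤ), fun j => ?_⟩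
    have h1 : openAdd A z i ρ j
        = (deg A z - applySeq A t (stabSeq A (fun k => k = z) t) z) * delta z j
          + applySeq A t (stabSeq A (fun k => k = z) t) j := by
      by_cases hj : j = z
      · subst hj; simp [delta, hz]
      · simp [delta, hj, hne j hj]
    rw [h1, applySeq_apply t _ j]
    simp only [ht, Pi.add_apply]
    ring

lemma openAddInv_spec (hEul : Eulerian A) (hConn : Connected A) {ρ : V → ℤ} (hρ : ZRec A z ρ)
    (i : V) : ZRec A z (openAddInv A z i ρ) ∧
      (openAddInv A z i ρ : SandGroup A z) + (delta i : V → ℤ) = ρ := by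
  have hex : ∃ ρ', ZRec A z ρ' ∧ openAdd A z i ρ' = ρ := by
    have hrec := zrec_Rz hEul hConn z (ρ - delta i)
    have hadd := openAdd_spec hEul hConn hrec i
    refine ⟨_, hrec, hadd.1.eq_of_mk_eq hEul hConn hρ ?_⟩
    rw [hadd.2, ← mk_Rz hEul hConn, QuotientAddGroup.mk_sub, sub_add_cancel]
  have h := hex.choose_spec
  rw [openAddInv, dif_pos hex]
  exact ⟨h.1, by rw [← (openAdd_spec hEul hConn h.1 i).2, h.2]⟩

end Decomposition

section Chain

variable {V : Type*} [Fintype V] [DecidableEq V] {A : V → V → ℕ} {z : V}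

lemma closedAdd_eq (A : V → V → ℕ) (i : V) (s : V → ℤ) :
    ∃ u : V → ℤ, ∀ j, closedAdd A i s j = s j + delta i j + lap A u j := by
  rw [closedAdd]
  split_ifs
  · exact ⟨_, applySeq_apply _ _⟩
  · exact ⟨0, fun j => by simp [lap_zero]⟩

lemma chain_eq (A : V → V → ℕ) (s : V → ℤ) (w : List V) :
    ∃ u : V → ℤ, ∀ j, chain A s w j = s j + w.count j + lap A u j := by
  induction w generalizing s with
  | nil => exact ⟨0, fun j => by simp [chain, lap_zero]⟩
  | cons i w ih =>
    obtain ⟨u, hu⟩ := ih (closedAdd A i s)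
    obtain ⟨u', hu'⟩ := closedAdd_eq A i s
    refine ⟨u + u', fun j => ?_⟩
    have h : chain A s (i :: w) = chain A (closedAdd A i s) w := rfl
    have hc : ((i :: w).count j : ℤ) = w.count j + delta i j := by
      by_cases hj : j = i
      · subst hj; simp [delta]
      · simp [delta, hj, List.count_cons_of_ne (Ne.symm hj)]
    rw [h, hu, hu', hc, lap_add]
    ring

lemma totalMass_chain (A : V → V → ℕ) (s : V → ℤ) (w : List V) :
    totalMass (chain A s w) = totalMass s + w.length := by
  obtain ⟨u, hu⟩ := chain_eq A s w
  have : ∑ j, (w.count j : ℤ) = w.length := by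
    have := Multiset.toFinset_sum_count_eq (w : Multiset V)
    simp only [Multiset.coe_count, Multiset.coe_card] at this
    rw [← this, Nat.cast_sum]
    refine (Finset.sum_subset (Finset.subset_univ _) fun j _ hj => ?_).symm
    simpa [List.count_eq_zero] using hj
  simp only [totalMass, hu, Finset.sum_add_distrib, sum_lap, this, add_zero]

lemma stabilizable_chain_of_prefix (hEul : Eulerian A) {s : V → ℤ} {w w' : List V} (hw : w' <+: w)
    (h : Stabilizable A (chain A s w)) : Stabilizable A (chain A s w') := by
  obtain ⟨u, hu⟩ := chain_eq A s w
  obtain ⟨u', hu'⟩ := chain_eq A s w'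
  rw [funext hu', stabilizable_add_lap_iff hEul]
  rw [funext hu, stabilizable_add_lap_iff hEul] at h
  refine h.mono hEul fun i => ?_
  have := hw.sublist.count_le i
  omega

/-- The class of a word in the sandpile group. -/
def wordClass (A : V → V → ℕ) (z : V) (w : List V) : SandGroup A z :=
  (w.map fun i => ((delta i : V → ℤ) : SandGroup A z)).sum

lemma mk_chain (A : V → V → ℕ) (z : V) (s : V → ℤ) (w : List V) :
    (chain A s w : SandGroup A z) = (s : SandGroup A z) + wordClass A z w := by
  induction w generalizing s with
  | nil => simp [chain, wordClass]
  | cons i w ih =>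
    have h : chain A s (i :: w) = chain A (closedAdd A i s) w := rfl
    obtain ⟨u, hu⟩ := closedAdd_eq A i s
    have h2 : (closedAdd A i s : SandGroup A z) = (s : SandGroup A z) + (delta i : V → ℤ) := by
      rw [← QuotientAddGroup.mk_add, eq_comm, mk_eq_mk_iff]
      exact ⟨0, u, fun j => by rw [hu, Pi.add_apply]; ring⟩
    rw [h, ih, h2, wordClass, wordClass, List.map_cons, List.sum_cons, add_assoc]

end Chain

section RandomWalk

variable {V : Type*} [Fintype V] [DecidableEq V] {Q : Type*} [AddCommGroup Q]

/-- The law of the random walk on `Q` started at `0`, with step `d j` having probability `α j`. -/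
def walkLaw (α : V → ℝ) (d : V → Q) : ℕ → Q → ℝ
  | 0, x => if x = 0 then 1 else 0
  | n + 1, x => ∑ j, α j * walkLaw α d n (x - d j)

variable {α : V → ℝ} {d : V → Q}

lemma walkLaw_nonneg (hα : ∀ j, 0 < α j) (n : ℕ) (x : Q) : 0 ≤ walkLaw α d n x := by
  induction n generalizing x with
  | zero => rw [walkLaw]; split_ifs <;> simp
  | succ n ih =>
    rw [walkLaw]
    exact Finset.sum_nonneg fun j _ => mul_nonneg (hα j).le (ih _)

lemma walkLaw_pos_add (hα : ∀ j, 0 < α j) {n : ℕ} {x : Q} (hx : 0 < walkLaw α d n x) (j : V) :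
    0 < walkLaw α d (n + 1) (x + d j) := by
  rw [walkLaw]
  refine Finset.sum_pos' (fun k _ => mul_nonneg (hα k).le (walkLaw_nonneg hα _ _))
    ⟨j, Finset.mem_univ _, ?_⟩
  rw [add_sub_cancel_right]
  exact mul_pos (hα j) hx

lemma walkLaw_pos_mono (hα : ∀ j, 0 < α j) {z : V} (hz : d z = 0) {n m : ℕ} (hnm : n ≤ m) {x : Q}
    (hx : 0 < walkLaw α d n x) : 0 < walkLaw α d m x := by
  induction m, hnm using Nat.le_induction with
  | base => exact hx
  | succ m _ ih => simpa [hz] using walkLaw_pos_add hα ih z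

lemma exists_walkLaw_pos [Finite Q] (hα : ∀ j, 0 < α j) {z : V} (hz : d z = 0)
    (hgen : AddSubgroup.closure (Set.range d) = ⊤) : ∃ N, ∀ x, 0 < walkLaw α d N x := by
  have hone : ∀ x : Q, ∃ n, 0 < walkLaw α d n x := fun x => by
    have hx : x ∈ AddSubmonoid.closure (Set.range d) := by
      rw [← AddSubgroup.closure_toAddSubmonoid_of_finite, hgen]
      trivial
    induction hx using AddSubmonoid.closure_induction_right with
    | zero => exact ⟨0, by simp [walkLaw]⟩
    | add_right x _ y hy ih =>
      obtain ⟨j, rfl⟩ := hy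
      obtain ⟨n, hn⟩ := ih
      exact ⟨n + 1, walkLaw_pos_add hα hn j⟩
  choose n hn using hone
  obtain ⟨N, hN⟩ := (Set.finite_range n).bddAbove
  exact ⟨N, fun x => walkLaw_pos_mono hα hz (hN ⟨x, rfl⟩) (hn x)⟩

variable [Fintype Q]

lemma sum_walkLaw (hsum : ∑ j, α j = 1) (n : ℕ) : ∑ x, walkLaw α d n x = 1 := by
  induction n with
  | zero => simp [walkLaw]
  | succ n ih =>
    simp only [walkLaw]
    rw [Finset.sum_comm]
    simp only [← Finset.mul_sum]
    rw [← hsum]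
    refine Finset.sum_congr rfl fun j _ => ?_
    have h := (Equiv.subRight (d j)).sum_comp (walkLaw α d n)
    simp only [Equiv.subRight_apply] at h
    rw [h, ih, mul_one]

lemma walkLaw_add (m n : ℕ) (x : Q) :
    walkLaw α d (m + n) x = ∑ y, walkLaw α d m y * walkLaw α d n (x - y) := by
  induction m generalizing x with
  | zero => simp [walkLaw]
  | succ m ih =>
    rw [add_right_comm]
    simp only [walkLaw, ih, Finset.sum_mul, Finset.mul_sum]
    rw [Finset.sum_comm (s := (Finset.univ : Finset Q))]
    refine Finset.sum_congr rfl fun j _ => ?_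
    rw [← (Equiv.subRight (d j)).sum_comp]
    refine Finset.sum_congr rfl fun y _ => ?_
    simp only [Equiv.subRight_apply]
    rw [show x - d j - (y - d j) = x - y by abel, mul_assoc]

/-- Doeblin's argument: the walk converges to the uniform distribution. -/
lemma walkLaw_tendsto_uniform (hα : ∀ j, 0 < α j) (hsum : ∑ j, α j = 1) {z : V} (hz : d z = 0)
    (hgen : AddSubgroup.closure (Set.range d) = ⊤) {ε : ℝ} (hε : 0 < ε) :
    ∃ n₀, ∀ n, n₀ ≤ n → ∀ x, |walkLaw α d n x - 1 / Fintype.card Q| ≤ ε := by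
  obtain ⟨N, hN⟩ := exists_walkLaw_pos hα hz hgen
  obtain ⟨x₀, hx₀⟩ := Finite.exists_min (walkLaw α d N)
  set c := walkLaw α d N x₀
  have hcard : (0 : ℝ) < Fintype.card Q := Nat.cast_pos.2 Fintype.card_pos
  set g : ℕ → Q → ℝ := fun n x => walkLaw α d n x - 1 / Fintype.card Q with hg
  have hg0 : ∀ n x, ∑ y, g n (x - y) = 0 := fun n x => by
    have h := (Equiv.subLeft x).sum_comp (g n)
    simp only [Equiv.subLeft_apply] at h
    rw [h]
    simp only [hg, Finset.sum_sub_distrib, sum_walkLaw hsum, Finset.sum_const, Finset.card_univ,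
      nsmul_eq_mul]
    field_simp
    ring
  have hconv : ∀ m n x, g (m + n) x = ∑ y, walkLaw α d m y * g n (x - y) := fun m n x => by
    simp only [hg, mul_sub, Finset.sum_sub_distrib, ← Finset.sum_mul, sum_walkLaw hsum, one_mul,
      walkLaw_add m n x]
  have hmono : ∀ n C, (∀ x, |g n x| ≤ C) → ∀ m x, |g (m + n) x| ≤ C := fun n C h m x => by
    rw [hconv]
    calc |∑ y, walkLaw α d m y * g n (x - y)|
        ≤ ∑ y, walkLaw α d m y * C := (Finset.abs_sum_le_sum_abs _ _).trans
          (Finset.sum_le_sum fun y _ => by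
            rw [abs_mul, abs_of_nonneg (walkLaw_nonneg hα _ _)]
            exact mul_le_mul_of_nonneg_left (h _) (walkLaw_nonneg hα _ _))
      _ = C := by rw [← Finset.sum_mul, sum_walkLaw hsum, one_mul]
  set θ := 1 - c * Fintype.card Q with hθ
  have hθ' : ∑ y : Q, (walkLaw α d N y - c) = θ := by
    rw [Finset.sum_sub_distrib, sum_walkLaw hsum, Finset.sum_const, Finset.card_univ, nsmul_eq_mul,
      hθ, mul_comm]
  have hθ0 : 0 ≤ θ := hθ' ▸ Finset.sum_nonneg fun y _ => sub_nonneg.2 (hx₀ y)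
  have hθ1 : θ < 1 := by
    have := mul_pos (hN x₀) hcard
    linarith
  have hcontr : ∀ n C, (∀ x, |g n x| ≤ C) → ∀ x, |g (N + n) x| ≤ θ * C := fun n C h x => by
    have h1 : g (N + n) x = ∑ y, (walkLaw α d N y - c) * g n (x - y) := by
      simp only [sub_mul, Finset.sum_sub_distrib, ← Finset.mul_sum, hg0, mul_zero, sub_zero, hconv]
    rw [h1, ← hθ', Finset.sum_mul]
    refine (Finset.abs_sum_le_sum_abs _ _).trans (Finset.sum_le_sum fun y _ => ?_)
    rw [abs_mul, abs_of_nonneg (sub_nonneg.2 (hx₀ y))]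
    exact mul_le_mul_of_nonneg_left (h _) (sub_nonneg.2 (hx₀ y))
  have hpow : ∀ k x, |g (k * N) x| ≤ θ ^ k := fun k => by
    induction k with
    | zero =>
      intro x
      have h1 : (1 : ℝ) / Fintype.card Q ≤ 1 := by
        rw [div_le_one hcard]
        exact_mod_cast Fintype.card_pos (α := Q)
      have h2 : (0 : ℝ) ≤ 1 / Fintype.card Q := by positivity
      simp only [hg, Nat.zero_mul, walkLaw, pow_zero, abs_le]
      split_ifs <;> constructor <;> linarith
    | succ k ih =>
      intro x
      rw [Nat.succ_mul, Nat.add_comm, pow_succ']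
      exact hcontr _ _ ih x
  obtain ⟨k, hk⟩ := exists_pow_lt_of_lt_one hε hθ1
  refine ⟨k * N, fun n hn x => ?_⟩
  have := hmono _ _ (hpow k) (n - k * N) x
  rw [Nat.sub_add_cancel hn] at this
  exact this.trans hk.le

end RandomWalk

section Words

variable {V : Type*} [Fintype V] [DecidableEq V]

/-- The words of length `n`. -/
def words (V : Type*) [Fintype V] [DecidableEq V] : ℕ → Finset (List V)
  | 0 => {[]}
  | n + 1 => (Finset.univ ×ˢ words V n).image fun p => p.1 :: p.2

lemma mem_words {n : ℕ} {w : List V} : w ∈ words V n ↔ w.length = n := by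
  induction n generalizing w with
  | zero => simp [words]
  | succ n ih =>
    cases w with
    | nil => simp [words]
    | cons i w => simp [words, ih]

lemma walkLaw_eq_sum_words {Q : Type*} [AddCommGroup Q] (α : V → ℝ) (d : V → Q) (n : ℕ) (x : Q) :
    walkLaw α d n x = ∑ w ∈ words V n, if (w.map d).sum = x then wordProb α w else 0 := by
  induction n generalizing x with
  | zero => simp [walkLaw, words, wordProb, eq_comm]
  | succ n ih =>
    rw [words, Finset.sum_image, Finset.sum_product, walkLaw]
    · refine Finset.sum_congr rfl fun j _ => ?_
      rw [ih, Finset.mul_sum]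
      refine Finset.sum_congr rfl fun w _ => ?_
      simp only [List.map_cons, List.sum_cons, wordProb, List.prod_cons, mul_ite, mul_zero,
        eq_sub_iff_add_eq']
    · rintro ⟨i, w⟩ - ⟨j, w'⟩ - h
      simpa using h

end Words

section Threshold

variable {V : Type*} [Fintype V] [DecidableEq V] {A : V → V → ℕ} {z : V}

lemma closure_range_mk_delta (A : V → V → ℕ) (z : V) :
    AddSubgroup.closure (Set.range fun i => ((delta i : V → ℤ) : SandGroup A z)) = ⊤ := by
  rw [eq_top_iff]
  rintro x -
  induction x using QuotientAddGroup.induction_on with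
  | H s =>
    have h : s = ∑ i, s i • (delta i : V → ℤ) := by
      ext j
      simp [delta]
    rw [h, QuotientAddGroup.mk_sum]
    refine sum_mem fun i _ => ?_
    rw [QuotientAddGroup.mk_zsmul]
    exact zsmul_mem (AddSubgroup.subset_closure (Set.mem_range_self i)) _

lemma mk_delta_self (A : V → V → ℕ) (z : V) : ((delta z : V → ℤ) : SandGroup A z) = 0 := by
  rw [QuotientAddGroup.eq_zero_iff]
  exact ⟨1, 0, fun j => by simp [lap_zero]⟩

/-- Words reaching the threshold with prescribed epicenter, recurrent part and `m_z`. -/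
lemma isThresholdWord_iff (hEul : Eulerian A) (hConn : Connected A) {ρ : V → ℤ} (hρ : ZRec A z ρ)
    (i : V) (m : ℕ) (s : V → ℤ) (w : List V) :
    (IsThresholdWord A s w ∧ w.getLast? = some i ∧ Rz A z (chain A s w) = ρ ∧
        mz A z (chain A s w) = m) ↔
      (m : ℤ) ≤ totalMass (openAddInv A z i ρ) - totalMass ρ ∧
      ∃ w', w = w' ++ [i] ∧ (w'.length : ℤ) + 1 = totalMass ρ + m - totalMass s ∧
        wordClass A z w' = (openAddInv A z i ρ : SandGroup A z) - (s : SandGroup A z) := by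
  obtain ⟨hinv, hinv'⟩ := openAddInv_spec hEul hConn hρ i
  set ρ' := openAddInv A z i ρ
  have hR : ∀ w', Rz A z (chain A s (w' ++ [i])) = ρ ↔
      wordClass A z w' = (ρ' : SandGroup A z) - (s : SandGroup A z) := fun w' => by
    rw [Rz_eq_iff hEul hConn hρ, mk_chain, wordClass, List.map_append, List.sum_append,
      List.map_singleton, List.sum_singleton, ← wordClass, ← hinv', ← add_assoc, add_left_inj,
      eq_sub_iff_add_eq']
  have hR' : ∀ w', wordClass A z w' = (ρ' : SandGroup A z) - (s : SandGroup A z) →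
      Rz A z (chain A s w') = ρ' := fun w' h => by
    rw [Rz_eq_iff hEul hConn hinv, mk_chain, h, add_sub_cancel]
  constructor
  · rintro ⟨⟨-, hpre⟩, hlast, hRz, hm⟩
    obtain ⟨w', rfl⟩ := List.getLast?_eq_some_iff.1 hlast
    have hcls := (hR w').1 hRz
    have hst := hpre w' (List.prefix_append _ _) (by simp)
    rw [stabilizable_iff_mz_neg hEul hConn z, mz_eq_sub hEul hConn, hR' w' hcls,
      totalMass_chain] at hst
    rw [mz_eq_sub hEul hConn, hRz, totalMass_chain] at hm
    simp only [List.length_append, List.length_singleton, Nat.cast_add, Nat.cast_one] at hm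
    exact ⟨by omega, w', rfl, by omega, hcls⟩
  · rintro ⟨hle, w', rfl, hlen, hcls⟩
    have hRz := (hR w').2 hcls
    have hm : mz A z (chain A s (w' ++ [i])) = m := by
      rw [mz_eq_sub hEul hConn, hRz, totalMass_chain]
      simp only [List.length_append, List.length_singleton, Nat.cast_add, Nat.cast_one]
      omega
    refine ⟨⟨?_, fun w'' hw hne => ?_⟩, by simp, hRz, hm⟩
    · rw [stabilizable_iff_mz_neg hEul hConn z, hm]
      omega
    · refine stabilizable_chain_of_prefix hEul ((List.prefix_concat_iff.1 hw).resolve_left hne) ?_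
      rw [stabilizable_iff_mz_neg hEul hConn z, mz_eq_sub hEul hConn, hR' w' hcls, totalMass_chain]
      omega

lemma thresholdProb_eq_zero (hEul : Eulerian A) (hConn : Connected A) (α : V → ℝ) {ρ : V → ℤ}
    (hρ : ZRec A z ρ) (i : V) (m : ℕ) (s : V → ℤ)
    (hm : ¬(m : ℤ) ≤ totalMass (openAddInv A z i ρ) - totalMass ρ) :
    thresholdProb A α s (fun w => w.getLast? = some i ∧ Rz A z (chain A s w) = ρ ∧
      mz A z (chain A s w) = (m : ℤ)) = 0 := by
  simp only [thresholdProb, isThresholdWord_iff hEul hConn hρ, hm, false_and, if_false, tsum_zero]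

lemma thresholdProb_eq_walkLaw (hEul : Eulerian A) (hConn : Connected A) (α : V → ℝ) {ρ : V → ℤ}
    (hρ : ZRec A z ρ) (i : V) (m : ℕ) (s : V → ℤ)
    (hm : (m : ℤ) ≤ totalMass (openAddInv A z i ρ) - totalMass ρ) {n : ℕ}
    (hn : (n : ℤ) + 1 = totalMass ρ + m - totalMass s) :
    thresholdProb A α s (fun w => w.getLast? = some i ∧ Rz A z (chain A s w) = ρ ∧
      mz A z (chain A s w) = (m : ℤ))
      = α i * walkLaw α (fun j => ((delta j : V → ℤ) : SandGroup A z)) n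
          ((openAddInv A z i ρ : SandGroup A z) - (s : SandGroup A z)) := by
  simp only [thresholdProb, isThresholdWord_iff hEul hConn hρ, hm, true_and, ← hn]
  rw [tsum_eq_sum (s := (words V n).image fun w => w ++ [i]), Finset.sum_image,
    walkLaw_eq_sum_words, Finset.mul_sum]
  · refine Finset.sum_congr rfl fun w hw => ?_
    have h : (∃ w', w ++ [i] = w' ++ [i] ∧ (w'.length : ℤ) + 1 = n + 1 ∧
        wordClass A z w' = (openAddInv A z i ρ : SandGroup A z) - (s : SandGroup A z)) ↔
        wordClass A z w = (openAddInv A z i ρ : SandGroup A z) - (s : SandGroup A z) := by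
      simp [mem_words.1 hw]
    simp only [h, mul_ite, mul_zero]
    refine if_congr Iff.rfl ?_ rfl
    simp [wordProb, mul_comm]
  · exact fun a _ b _ h => List.append_left_injective _ h
  · intro w hw
    refine if_neg ?_
    rintro ⟨w', rfl, hlen, -⟩
    exact hw (Finset.mem_image.2 ⟨w', mem_words.2 (by omega), rfl⟩)

end Threshold

end ThresholdState

open ThresholdState in
/-- **Theorem (main).** As `|s₀| → -∞`, the joint law of the epicenter `i_τ`, the
recurrent part `ρ_τ` and `m_τ` converges to
`(α_i/κ)·1{0 ≤ m ≤ |â_i⁻¹ρ| - |ρ|}`. -/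
theorem statement_0 {V : Type*} [Fintype V] [DecidableEq V]
    (A : V → V → ℕ) (hEul : Eulerian A) (hConn : Connected A)
    (α : V → ℝ) (hαpos : ∀ i, 0 < α i) (hαsum : ∑ i, α i = 1)
    (z : V) (i : V) (ρ : V → ℤ) (hρ : ZRec A z ρ) (m : ℕ) :
    ∀ ε : ℝ, 0 < ε → ∃ K : ℤ, K < 0 ∧ ∀ s0 : V → ℤ, totalMass s0 < K →
      |thresholdProb A α s0
          (fun w => w.getLast? = some i ∧ Rz A z (chain A s0 w) = ρ ∧
            mz A z (chain A s0 w) = (m : ℤ))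
        - α i / (kappa A z : ℝ) *
            (if (m : ℤ) ≤ totalMass (openAddInv A z i ρ) - totalMass ρ then 1 else 0)|
      ≤ ε := by
  intro ε hε
  have := finite_sandGroup hEul hConn z
  have := Fintype.ofFinite (SandGroup A z)
  obtain ⟨n₀, hn₀⟩ := walkLaw_tendsto_uniform hαpos hαsum (mk_delta_self A z)
    (closure_range_mk_delta A z) hε
  refine ⟨min (-1) (totalMass ρ + m - n₀ - 1), by omega, fun s hs => ?_⟩
  by_cases hm : (m : ℤ) ≤ totalMass (openAddInv A z i ρ) - totalMass ρ
  · obtain ⟨n, hn⟩ := Int.eq_ofNat_of_zero_le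
      (show 0 ≤ totalMass ρ + m - totalMass s - 1 by omega)
    have hα1 : α i ≤ 1 := hαsum ▸ Finset.single_le_sum (fun j _ => (hαpos j).le) (Finset.mem_univ i)
    rw [thresholdProb_eq_walkLaw hEul hConn α hρ i m s hm (n := n) (by omega), if_pos hm,
      kappa_eq_card hEul hConn, Nat.card_eq_fintype_card, mul_one, div_eq_mul_one_div, ← mul_sub,
      abs_mul, abs_of_pos (hαpos i)]
    exact (mul_le_of_le_one_left (abs_nonneg _) hα1).trans (hn₀ n (by omega) _)
  · rw [thresholdProb_eq_zero hEul hConn α hρ i m s hm, if_neg hm, mul_zero, sub_zero, abs_zero]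
    exact hε.le
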